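/- Let ρ0 and ρ1 be quantum states on ℂ^d with full support. Then the closure of the convex hull of C equals the closure of the convex hull of C^{(1)}, where C = ∪_𝒳 ∪_{m∈M_𝒳} {(R0,R1) ∈ ℝ₊² : R0 ≤ D(P_{ρ1,m}‖P_{ρ0,m}) and R1 ≤ D(P_{ρ0,m}‖P_{ρ1,m})} (𝒳 running over all finite sets, m over all POVMs with outcome set 𝒳) and C^{(1)} = ∪_{m∈M^{(1)}_{[d²]}} {(R0,R1) ∈ ℝ₊² : R0 ≤ D(P_{ρ1,m}‖P_{ρ0,m}) and R1 ≤ D(P_{ρ0,m}‖P_{ρ1,m})} with M^{(1)}_{[d²]} the set of POVMs indexed by {1,…,d²} all of whose elements have rank one. -/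

import Mathlib

open scoped ENNReal ComplexOrder

namespace SQHT

/-- `d × d` complex matrices over an index type `ι`. -/
abbrev Mat (ι : Type) := Matrix ι ι ℂ

variable {ι : Type} [Fintype ι] [DecidableEq ι]

/-- A quantum state: positive semidefinite with unit trace. -/
def IsState (ρ : Mat ι) : Prop := ρ.PosSemidef ∧ ρ.trace = 1

/-- A POVM with finite outcome set `Fin N`. -/
def IsPOVM {N : ℕ} (m : Fin N → Mat ι) : Prop :=
  (∀ x, (m x).PosSemidef) ∧ ∑ x, m x = 1

/-- Born probability of outcome `x` when measuring `m` on state `ρ`. -/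
noncomputable def outProb (ρ : Mat ι) {X : Type*} (m : X → Mat ι) (x : X) : ℝ :=
  ((ρ * m x).trace).re

/-- Classical relative entropy (KL divergence) of two pmfs on a finite set,
with the convention `0 log 0 = 0`. -/
noncomputable def KL {X : Type*} [Fintype X] (P Q : X → ℝ) : ℝ :=
  ∑ x, if P x = 0 then 0 else P x * Real.log (P x / Q x)

/-- The set `C`: union over all finite outcome sets and POVMs of the corresponding
exponent rectangles. -/
def Cset (ρ0 ρ1 : Mat ι) : Set (ℝ × ℝ) :=
  {R | 0 ≤ R.1 ∧ 0 ≤ R.2 ∧ ∃ (N : ℕ) (m : Fin N → Mat ι), IsPOVM m ∧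
    R.1 ≤ KL (outProb ρ1 m) (outProb ρ0 m) ∧
    R.2 ≤ KL (outProb ρ0 m) (outProb ρ1 m)}

/-- The set `C⁽¹⁾`: union over POVMs with `d²` outcomes, all of whose elements have
rank one, of the corresponding exponent rectangles. -/
def C1set (d : ℕ) (ρ0 ρ1 : Mat (Fin d)) : Set (ℝ × ℝ) :=
  {R | 0 ≤ R.1 ∧ 0 ≤ R.2 ∧ ∃ m : Fin (d * d) → Mat (Fin d),
    IsPOVM m ∧ (∀ x, (m x).rank = 1) ∧
    R.1 ≤ KL (outProb ρ1 m) (outProb ρ0 m) ∧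
    R.2 ≤ KL (outProb ρ0 m) (outProb ρ1 m)}

open Finset in
/-- Moving along a relation whose coefficients are somewhere negative, up to the boundary of the
positive orthant, strictly shrinks the support. -/
lemma exists_pos_add_smul_support_ssubset {κ : Type*} [Fintype κ] {w c : κ → ℝ}
    (hw : 0 ≤ w) (hc : ∀ x, w x = 0 → c x = 0) (hneg : ∃ x, c x < 0) :
    ∃ t : ℝ, 0 < t ∧ 0 ≤ w + t • c ∧
      #{x | (w + t • c) x ≠ 0} < #{x | w x ≠ 0} := by
  classical
  obtain ⟨x₀, hx₀, hmin⟩ := exists_min_image {x | c x < 0} (fun x => w x / -c x)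
    (by obtain ⟨x, hx⟩ := hneg; exact ⟨x, by simpa using hx⟩)
  simp only [mem_filter, mem_univ, true_and] at hx₀ hmin
  have hw₀ : 0 < w x₀ := lt_of_le_of_ne (hw x₀) fun h => hx₀.ne (hc x₀ h.symm)
  refine ⟨w x₀ / -c x₀, div_pos hw₀ (by linarith), fun x => ?_, card_lt_card ?_⟩
  · have hpos : 0 < w x₀ / -c x₀ := div_pos hw₀ (by linarith)
    simp only [Pi.zero_apply, Pi.add_apply, Pi.smul_apply, smul_eq_mul]
    rcases lt_or_ge (c x) 0 with h | h
    · have := (le_div_iff₀ (by linarith : 0 < -c x)).1 (hmin x h)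
      linarith
    · have := mul_nonneg hpos.le h
      have := hw x
      simp only [Pi.zero_apply] at this
      linarith
  · refine (ssubset_iff_of_subset fun x => ?_).2 ⟨x₀, by simpa using hw₀.ne', ?_⟩
    · simp only [mem_filter, mem_univ, true_and, Pi.add_apply, Pi.smul_apply, smul_eq_mul]
      intro h hx
      simp [hx, hc x hx] at h
    · have : c x₀ ≠ 0 := hx₀.ne
      simp only [mem_filter, mem_univ, true_and, Pi.add_apply, Pi.smul_apply, smul_eq_mul, not_not]
      field_simp
      ring

open Finset in
/-- A nonnegative weight is a convex combination of nonnegative weights with the same weighted sum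
and support of size at most `D`, as soon as any more than `D` of the vectors satisfy a nontrivial
relation and all of them lie strictly on one side of a hyperplane. -/
lemma mem_convexHull_card_support_le {κ V : Type*} [Fintype κ] [AddCommGroup V] [Module ℝ V]
    (v : κ → V) (ℓ : V →ₗ[ℝ] ℝ) (hℓ : ∀ x, 0 < ℓ (v x)) (D : ℕ)
    (hD : ∀ s : Finset κ, D < #s →
      ∃ c : κ → ℝ, (∀ x ∉ s, c x = 0) ∧ c ≠ 0 ∧ ∑ x, c x • v x = 0)
    (b : V) (w : κ → ℝ) (hw : 0 ≤ w) (hwb : ∑ x, w x • v x = b) :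
    w ∈ convexHull ℝ {u : κ → ℝ | 0 ≤ u ∧ ∑ x, u x • v x = b ∧ #{x | u x ≠ 0} ≤ D} := by
  induction hn : #{x | w x ≠ 0} using Nat.strong_induction_on generalizing w with
  | _ n ih =>
  rcases le_or_gt n D with hnD | hnD
  · exact subset_convexHull _ _ ⟨hw, hwb, hn ▸ hnD⟩
  obtain ⟨c, hcs, hc0, hcv⟩ := hD {x | w x ≠ 0} (hn ▸ hnD)
  replace hcs : ∀ x, w x = 0 → c x = 0 := fun x hx => hcs x (by simpa using hx)
  have hsum : ∑ x, c x * ℓ (v x) = 0 := by simpa using congrArg ℓ hcv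
  have hneg : ∀ c : κ → ℝ, c ≠ 0 → ∑ x, c x * ℓ (v x) = 0 → ∃ x, c x < 0 := by
    intro c hc0 hsum
    by_contra! h
    refine hc0 (funext fun x => ?_)
    have := (sum_eq_zero_iff_of_nonneg fun x _ => mul_nonneg (h x) (hℓ x).le).1 hsum x (mem_univ x)
    exact (mul_eq_zero.1 this).resolve_right (hℓ x).ne'
  have step : ∀ c : κ → ℝ, ∑ x, c x • v x = 0 → ∀ t : ℝ,
      ∑ x, (w + t • c) x • v x = b := by
    intro c hcv t
    simp [add_smul, sum_add_distrib, mul_smul, ← smul_sum, hcv, hwb]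
  obtain ⟨s, hs, hs0, hsn⟩ := exists_pos_add_smul_support_ssubset hw hcs (hneg c hc0 hsum)
  obtain ⟨t, ht, ht0, htn⟩ := exists_pos_add_smul_support_ssubset (c := -c) hw
    (fun x hx => by simp [hcs x hx])
    (hneg (-c) (neg_ne_zero.2 hc0) (by simp [hsum]))
  have hA := ih _ (hn ▸ hsn) _ hs0 (step c hcv s) rfl
  have hB := ih _ (hn ▸ htn) _ ht0 (step (-c) (by simp [hcv]) t) rfl
  have hst : 0 < s + t := by positivity
  convert convex_convexHull ℝ _ hA hB (div_nonneg ht.le hst.le) (div_nonneg hs.le hst.le)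
    (by field_simp; ring) using 1
  ext x
  simp only [Pi.add_apply, Pi.smul_apply, smul_eq_mul, Pi.neg_apply]
  field_simp
  ring

/-- A family of Hermitian matrices that is larger than the complex dimension of the matrix space
satisfies a nontrivial real relation. -/
lemma exists_real_relation_of_isHermitian {κ : Type*} [Fintype κ] {d : ℕ}
    (E : κ → Mat (Fin d)) (hE : ∀ x, (E x).IsHermitian) (s : Finset κ) (hs : d * d < s.card) :
    ∃ c : κ → ℝ, (∀ x ∉ s, c x = 0) ∧ c ≠ 0 ∧ ∑ x, c x • E x = 0 := by
  classical
  have hdep : ¬ LinearIndependent ℂ fun x : s => E x := fun h => by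
    have := h.fintype_card_le_finrank
    simp [Module.finrank_matrix] at this
    omega
  obtain ⟨g, hg, x₀, hx₀⟩ := Fintype.not_linearIndependent_iff.1 hdep
  have hg' : ∑ x : s, star (g x) • E x = 0 := by
    have := congrArg Matrix.conjTranspose hg
    simpa [Matrix.conjTranspose_sum, Matrix.conjTranspose_smul, (hE _).eq] using this
  have extend : ∀ r : s → ℝ, r x₀ ≠ 0 → ∑ x : s, (r x : ℂ) • E x = 0 →
      ∃ c : κ → ℝ, (∀ x ∉ s, c x = 0) ∧ c ≠ 0 ∧ ∑ x, c x • E x = 0 := by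
    intro r hr hsum
    refine ⟨fun x => if h : x ∈ s then r ⟨x, h⟩ else 0, fun x hx => by simp [hx],
      fun h => hr (by simpa using congrFun h x₀), ?_⟩
    rw [← Finset.sum_subset s.subset_univ (fun x _ hx => by simp [hx]), ← Finset.sum_coe_sort,
      ← hsum]
    exact Finset.sum_congr rfl fun x _ => by
      ext i j
      simp
  by_cases hre : (g x₀).re = 0
  · refine extend (fun x => (g x).im) (fun him => hx₀ (Complex.ext hre him)) ?_
    have h : ∑ x : s, (2 * Complex.I) • (((g x).im : ℂ) • E x) = 0 := by
      rw [← sub_zero (0 : Mat (Fin d))]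
      nth_rewrite 1 [← hg]
      rw [← hg', ← Finset.sum_sub_distrib]
      refine Finset.sum_congr rfl fun x _ => ?_
      rw [← sub_smul, smul_smul]
      congr 1
      apply Complex.ext <;> simp
      ring
    rw [← Finset.smul_sum] at h
    exact (smul_eq_zero.1 h).resolve_left (by simp)
  · refine extend (fun x => (g x).re) hre ?_
    have h : ∑ x : s, (2 : ℂ) • (((g x).re : ℂ) • E x) = 0 := by
      rw [← add_zero (0 : Mat (Fin d))]
      nth_rewrite 1 [← hg]
      rw [← hg', ← Finset.sum_add_distrib]
      refine Finset.sum_congr rfl fun x _ => ?_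
      rw [← add_smul, smul_smul]
      congr 1
      apply Complex.ext <;> simp
      ring
    rw [← Finset.smul_sum] at h
    exact (smul_eq_zero.1 h).resolve_left (by simp)

lemma KL_eq_sum {X : Type*} [Fintype X] (P Q : X → ℝ) :
    KL P Q = ∑ x, P x * Real.log (P x / Q x) :=
  Finset.sum_congr rfl fun x _ => by split_ifs with h <;> simp [h]

/-- The log-sum inequality. -/
lemma sum_mul_log_div_sum_le {X : Type*} (s : Finset X) (a b : X → ℝ)
    (ha : ∀ x ∈ s, 0 ≤ a x) (hb : ∀ x ∈ s, 0 ≤ b x) (hab : ∀ x ∈ s, b x = 0 → a x = 0) :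
    (∑ x ∈ s, a x) * Real.log ((∑ x ∈ s, a x) / ∑ x ∈ s, b x) ≤
      ∑ x ∈ s, a x * Real.log (a x / b x) := by
  rcases (Finset.sum_nonneg ha).eq_or_lt with hA | hA
  · have h0 := (Finset.sum_eq_zero_iff_of_nonneg ha).1 hA.symm
    rw [← hA, zero_mul]
    exact (Finset.sum_eq_zero fun x hx => by simp [h0 x hx]).ge
  have hB : 0 < ∑ x ∈ s, b x := by
    refine (Finset.sum_nonneg hb).lt_of_ne fun h => hA.ne' ?_
    have h0 := (Finset.sum_eq_zero_iff_of_nonneg hb).1 h.symm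
    exact Finset.sum_eq_zero fun x hx => hab x hx (h0 x hx)
  set A := ∑ x ∈ s, a x
  set B := ∑ x ∈ s, b x
  calc A * Real.log (A / B) = ∑ x ∈ s, (a x * Real.log (A / B) + a x - b x * (A / B)) := by
        rw [Finset.sum_sub_distrib, Finset.sum_add_distrib, ← Finset.sum_mul, ← Finset.sum_mul]
        change _ = A * _ + A - B * (A / B)
        field_simp
        ring
    _ ≤ _ := Finset.sum_le_sum fun x hx => by
        rcases (ha x hx).eq_or_lt with h | h
        · have := mul_nonneg (hb x hx) (div_pos hA hB).le
          simp [← h, this]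
        have hbx : 0 < b x := (hb x hx).lt_of_ne fun h0 => h.ne' (hab x hx h0.symm)
        have key := Real.log_le_sub_one_of_pos
          (div_pos (div_pos hA hB) (div_pos h hbx))
        rw [Real.log_div (div_pos hA hB).ne' (div_pos h hbx).ne'] at key
        have := mul_le_mul_of_nonneg_left key h.le
        have e : a x * (A / B / (a x / b x) - 1) = b x * (A / B) - a x := by
          field_simp
        rw [e] at this
        linarith

/-- The expectation of a state in the rank-one operator spanned by a vector. -/
lemma re_trace_mul_vecMulVec_pos {α : Type} [Fintype α]
    {ρ : Mat α} (hρ : ρ.PosDef) {v : α → ℂ} (hv : v ≠ 0) :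
    0 < ((ρ * Matrix.vecMulVec v (star v)).trace).re := by
  rw [Matrix.mul_vecMulVec, Matrix.trace_vecMulVec, dotProduct_comm]
  exact (Complex.pos_iff.1 (hρ.dotProduct_mulVec_pos hv)).1

lemma rank_smul_vecMulVec_star {α : Type} [Fintype α]
    {v : α → ℂ} (hv : v ≠ 0) {r : ℝ} (hr : r ≠ 0) :
    (r • Matrix.vecMulVec v (star v)).rank = 1 := by
  have hsmul : r • Matrix.vecMulVec v (star v) = Matrix.vecMulVec (r • v) (star v) := by
    ext i j
    simp [Matrix.vecMulVec_apply, mul_assoc]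
  refine le_antisymm (hsmul ▸ Matrix.rank_vecMulVec_le _ _) (Nat.one_le_iff_ne_zero.2 fun h => ?_)
  rw [Matrix.rank, Submodule.finrank_eq_zero, LinearMap.range_eq_bot] at h
  have h0 : r • Matrix.vecMulVec v (star v) = 0 :=
    Matrix.mulVec_injective (funext fun x =>
      (LinearMap.congr_fun h x).trans (Matrix.zero_mulVec x).symm)
  obtain ⟨i, hi⟩ := Function.ne_iff.1 hv
  have := congrFun (congrFun h0 i) i
  simp [Matrix.vecMulVec_apply, hr] at this
  exact hi this

lemma outProb_smul (ρ : Mat ι) {X : Type*} (r : X → ℝ) (E : X → Mat ι) (x : X) :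
    outProb ρ (fun y => r y • E y) x = r x * outProb ρ E x := by
  simp [outProb]

lemma sum_outProb {ρ : Mat ι} (hρ : ρ.trace = 1) {X : Type*} [Fintype X] {m : X → Mat ι}
    (hm : ∑ x, m x = 1) : ∑ x, outProb ρ m x = 1 := by
  simp only [outProb]
  rw [← Complex.re_sum, ← Matrix.trace_sum, ← Finset.mul_sum, hm, mul_one, hρ, Complex.one_re]

/-- Splitting outcomes over the fibres of a surjection preserves weighted sums. -/
lemma sum_inv_card_fiber_smul {X Y M : Type*} [Fintype X] [Fintype Y] [DecidableEq X]
    [AddCommGroup M] [Module ℝ M] {π : Y → X} (hπ : Function.Surjective π) (G : X → M) :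
    ∑ y, ((Finset.univ.filter fun z => π z = π y).card : ℝ)⁻¹ • G (π y) = ∑ x, G x := by
  rw [← Finset.sum_fiberwise _ π]
  refine Finset.sum_congr rfl fun x _ => ?_
  rw [Finset.sum_congr rfl (g := fun _ =>
    ((Finset.univ.filter fun z => π z = x).card : ℝ)⁻¹ • G x)
    (fun y hy => by rw [(Finset.mem_filter.1 hy).2])]
  rw [Finset.sum_const, ← Nat.cast_smul_eq_nsmul ℝ, smul_smul, mul_inv_cancel₀, one_smul]
  obtain ⟨y, hy⟩ := hπ x
  exact Nat.cast_ne_zero.2 (Finset.card_ne_zero.2 ⟨y, by simpa using hy⟩)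

/-- Relative entropy is additive under weighting and splitting of outcomes. -/
lemma KL_outProb_smul {X Y : Type*} [Fintype Y] (ρ σ : Mat ι) (r : Y → ℝ) (hr : ∀ y, 0 < r y)
    (E : X → Mat ι) (π : Y → X) :
    KL (outProb ρ fun y => r y • E (π y)) (outProb σ fun y => r y • E (π y)) =
      ∑ y, r y * (outProb ρ E (π y) * Real.log (outProb ρ E (π y) / outProb σ E (π y))) := by
  rw [KL_eq_sum]
  refine Finset.sum_congr rfl fun y _ => ?_
  rw [outProb_smul, outProb_smul, mul_div_mul_left _ _ (hr y).ne', mul_assoc]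
  rfl

/-- A rank-one POVM, given as a nonnegative weight of small support on a family of rank-one
operators, can be realised with exactly `d * d` rank-one outcomes. -/
lemma exists_rank_one_POVM {κ : Type*} [Fintype κ] {d : ℕ} (hd : 0 < d)
    (v : κ → Fin d → ℂ) (hv : ∀ k, v k ≠ 0) (u : κ → ℝ) (hu : 0 ≤ u)
    (hsum : ∑ k, u k • Matrix.vecMulVec (v k) (star (v k)) = 1)
    (hcard : (Finset.univ.filter fun k => u k ≠ 0).card ≤ d * d) :
    ∃ m : Fin (d * d) → Mat (Fin d), IsPOVM m ∧ (∀ x, (m x).rank = 1) ∧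
      ∀ ρ σ : Mat (Fin d), KL (outProb ρ m) (outProb σ m) =
        ∑ k, u k * (outProb ρ (fun k => Matrix.vecMulVec (v k) (star (v k))) k *
          Real.log (outProb ρ (fun k => Matrix.vecMulVec (v k) (star (v k))) k /
            outProb σ (fun k => Matrix.vecMulVec (v k) (star (v k))) k)) := by
  classical
  set E : κ → Mat (Fin d) := fun k => Matrix.vecMulVec (v k) (star (v k)) with hE
  set s : Finset κ := Finset.univ.filter fun k => u k ≠ 0 with hs
  have sum_s : ∀ {M : Type} [AddCommGroup M] [Module ℝ M] (G : κ → M),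
      ∑ x : s, u x • G x = ∑ k, u k • G k := by
    intro M _ _ G
    rw [Finset.sum_coe_sort s fun k => u k • G k]
    exact Finset.sum_subset s.subset_univ fun x _ hx => by
      rw [(by simpa [hs] using hx : u x = 0), zero_smul]
  have hne : Nonempty s := by
    by_contra h
    rw [not_nonempty_iff] at h
    have h1 := sum_s E
    rw [Fintype.sum_empty, hsum] at h1
    have := congrFun (congrFun h1 ⟨0, hd⟩) ⟨0, hd⟩
    simp at this
  obtain ⟨e⟩ := Function.Embedding.nonempty_of_card_le
    (α := s) (β := Fin (d * d)) (by simpa using hcard)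
  obtain ⟨π, hπ⟩ : ∃ π : Fin (d * d) → s, Function.Surjective π :=
    ⟨_, Function.invFun_surjective e.injective⟩
  have hn : ∀ y, 0 < (((Finset.univ.filter fun z => π z = π y).card : ℝ)⁻¹) := fun y =>
    inv_pos.2 (Nat.cast_pos.2 (Finset.card_pos.2 ⟨y, by simp⟩))
  have hus : ∀ x : s, 0 < u x := fun x =>
    (hu x).lt_of_ne fun h => (Finset.mem_filter.1 x.2).2 h.symm
  refine ⟨fun y => (((Finset.univ.filter fun z => π z = π y).card : ℝ)⁻¹ * u (π y)) • E (π y),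
    ⟨fun y => ?_, ?_⟩, fun y => ?_, fun ρ σ => ?_⟩
  · exact (Matrix.posSemidef_vecMulVec_self_star _).smul (mul_pos (hn y) (hus _)).le
  · simp only [mul_smul]
    rw [sum_inv_card_fiber_smul hπ fun x : s => u x • E x, sum_s, hsum]
  · exact rank_smul_vecMulVec_star (hv _) (mul_pos (hn y) (hus _)).ne'
  · rw [KL_outProb_smul ρ σ _ (fun y => mul_pos (hn y) (hus _)) E fun y => (π y : κ)]
    simp only [mul_assoc]
    have := sum_inv_card_fiber_smul hπ fun x : s =>
      u x • (outProb ρ E x * Real.log (outProb ρ E x / outProb σ E x))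
    rw [sum_s fun k => outProb ρ E k * Real.log (outProb ρ E k / outProb σ E k)] at this
    simpa only [smul_eq_mul] using this

/-- Refining a measurement into rank-one operators does not decrease relative entropy. -/
lemma KL_outProb_le_sum {α : Type} [Fintype α] {κ : Type*} [Fintype κ] {N : ℕ} {m : Fin N → Mat α}
    {E : κ → Mat α} (f : κ → Fin N) (hm : ∀ x, m x = ∑ k with f k = x, E k)
    (ρ σ : Mat α) (hρ : ∀ k, 0 < outProb ρ E k) (hσ : ∀ k, 0 < outProb σ E k) :
    KL (outProb ρ m) (outProb σ m) ≤
      ∑ k, outProb ρ E k * Real.log (outProb ρ E k / outProb σ E k) := by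
  have hsum : ∀ (τ : Mat α) x, outProb τ m x = ∑ k with f k = x, outProb τ E k := by
    intro τ x
    simp only [outProb, hm x]
    rw [Finset.mul_sum, Matrix.trace_sum, Complex.re_sum]
  rw [KL_eq_sum, ← Finset.sum_fiberwise Finset.univ f]
  refine Finset.sum_le_sum fun x _ => ?_
  rw [hsum, hsum]
  exact sum_mul_log_div_sum_le _ _ _ (fun k _ => (hρ k).le) (fun k _ => (hσ k).le)
    fun k _ h => ((hσ k).ne' h).elim

/-- Relative entropy is nonnegative on rank-one measurements. -/
lemma sum_mul_outProb_mul_log_nonneg {κ : Type*} [Fintype κ] {E : κ → Mat ι} {u : κ → ℝ}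
    (hu : 0 ≤ u) (hsum : ∑ k, u k • E k = 1) {ρ σ : Mat ι} (hρ : ρ.trace = 1) (hσ : σ.trace = 1)
    (hρE : ∀ k, 0 < outProb ρ E k) (hσE : ∀ k, 0 < outProb σ E k) :
    0 ≤ ∑ k, u k * (outProb ρ E k * Real.log (outProb ρ E k / outProb σ E k)) := by
  have h := sum_mul_log_div_sum_le Finset.univ
    (outProb ρ fun k => u k • E k) (outProb σ fun k => u k • E k)
    (fun k _ => by rw [outProb_smul]; exact mul_nonneg (hu k) (hρE k).le)
    (fun k _ => by rw [outProb_smul]; exact mul_nonneg (hu k) (hσE k).le)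
    (fun k _ h => by
      rw [outProb_smul] at h ⊢
      rw [(mul_eq_zero.1 h).resolve_right (hσE k).ne', zero_mul])
  rw [sum_outProb hρ hsum, sum_outProb hσ hsum] at h
  simp only [div_one, Real.log_one, mul_zero] at h
  refine h.trans_eq (Finset.sum_congr rfl fun k _ => ?_)
  rw [outProb_smul, outProb_smul, mul_assoc]
  rcases eq_or_ne (u k) 0 with h0 | h0
  · simp [h0]
  · rw [mul_div_mul_left _ _ h0]

/-- Every POVM refines to a family of nonzero rank-one operators. -/
lemma exists_rank_one_refinement {α : Type} [Fintype α]
    {N : ℕ} {m : Fin N → Mat α} (hm : ∀ x, (m x).PosSemidef) :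
    ∃ (κ : Type) (_ : Fintype κ) (v : κ → α → ℂ) (f : κ → Fin N), (∀ k, v k ≠ 0) ∧
      ∀ x, m x = ∑ k with f k = x, Matrix.vecMulVec (v k) (star (v k)) := by
  classical
  choose n v hv using fun x => Matrix.posSemidef_iff_eq_sum_vecMulVec.1 (hm x)
  refine ⟨{p : Σ x, Fin (n x) // v p.1 p.2 ≠ 0}, inferInstance, fun k => v k.1.1 k.1.2,
    fun k => k.1.1, fun k => k.2, fun x => ?_⟩
  set F : (Σ x, Fin (n x)) → Mat α := fun p =>
    if p.1 = x then Matrix.vecMulVec (v p.1 p.2) (star (v p.1 p.2)) else 0 with hF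
  have hsub : ∑ k : {p : Σ x, Fin (n x) // v p.1 p.2 ≠ 0}, F k = ∑ p, F p := by
    rw [← Finset.sum_subtype (Finset.univ.filter fun p : Σ x, Fin (n x) => v p.1 p.2 ≠ 0)
      (by simp) F]
    refine Finset.sum_subset (Finset.subset_univ _) fun p _ hp => ?_
    have : v p.1 p.2 = 0 := by simpa using hp
    simp [hF, this]
  rw [Finset.sum_filter]
  change _ = ∑ k : {p : Σ x, Fin (n x) // v p.1 p.2 ≠ 0}, F k
  rw [hsub, Fintype.sum_sigma, Finset.sum_eq_single x (by simp +contextual [hF]) (by simp)]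
  simpa [hF] using hv x

lemma exists_mem_Icc_mul_eq {r K : ℝ} (hr : 0 ≤ r) (hrK : r ≤ K) :
    ∃ t, 0 ≤ t ∧ t ≤ 1 ∧ t * K = r := by
  rcases (hr.trans hrK).eq_or_lt with h | h
  · exact ⟨0, le_rfl, zero_le_one, by linarith⟩
  · exact ⟨r / K, div_nonneg hr h.le, (div_le_one h).2 hrK, div_mul_cancel₀ _ h.ne'⟩

lemma Cset_subset_convexHull_C1set (d : ℕ) (hd : 0 < d) (ρ0 ρ1 : Mat (Fin d))
    (h0 : ρ0.trace = 1) (h1 : ρ1.trace = 1) (hfs0 : ρ0.PosDef) (hfs1 : ρ1.PosDef) :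
    Cset ρ0 ρ1 ⊆ convexHull ℝ (C1set d ρ0 ρ1) := by
  rintro R ⟨hR1, hR2, N, m, hm, hK1, hK2⟩
  obtain ⟨κ, _, v, f, hv, hmf⟩ := exists_rank_one_refinement hm.1
  set E : κ → Mat (Fin d) := fun k => Matrix.vecMulVec (v k) (star (v k)) with hE
  have hE0 : ∀ k, 0 < outProb ρ0 E k := fun k => re_trace_mul_vecMulVec_pos hfs0 (hv k)
  have hE1 : ∀ k, 0 < outProb ρ1 E k := fun k => re_trace_mul_vecMulVec_pos hfs1 (hv k)
  have hEsum : ∑ k, (1 : κ → ℝ) k • E k = 1 := by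
    simp only [Pi.one_apply, one_smul]
    rw [← hm.2, ← Finset.sum_fiberwise Finset.univ f]
    exact Finset.sum_congr rfl fun x _ => (hmf x).symm
  obtain ⟨t1, ht1, ht1', hRt1⟩ := exists_mem_Icc_mul_eq hR1
    (hK1.trans (KL_outProb_le_sum f hmf ρ1 ρ0 hE1 hE0))
  obtain ⟨t2, ht2, ht2', hRt2⟩ := exists_mem_Icc_mul_eq hR2
    (hK2.trans (KL_outProb_le_sum f hmf ρ0 ρ1 hE0 hE1))
  let ℓ : Mat (Fin d) →ₗ[ℝ] ℝ :=
    { toFun := fun A => ((ρ0 * A).trace).re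
      map_add' := fun A B => by simp [mul_add]
      map_smul' := fun r A => by simp }
  have hmem := mem_convexHull_card_support_le E ℓ hE0 (d * d)
    (exists_real_relation_of_isHermitian E fun k =>
      (Matrix.posSemidef_vecMulVec_self_star (v k)).1)
    1 1 zero_le_one hEsum
  let L : (κ → ℝ) →ₗ[ℝ] ℝ × ℝ :=
    (t1 • Fintype.linearCombination ℝ fun k =>
      outProb ρ1 E k * Real.log (outProb ρ1 E k / outProb ρ0 E k)).prod
    (t2 • Fintype.linearCombination ℝ fun k =>
      outProb ρ0 E k * Real.log (outProb ρ0 E k / outProb ρ1 E k))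
  have hL : R = L 1 := by
    ext
    · simpa [L, Fintype.linearCombination_apply] using hRt1.symm
    · simpa [L, Fintype.linearCombination_apply] using hRt2.symm
  rw [hL]
  refine convexHull_mono ?_ (L.image_convexHull _ ▸ Set.mem_image_of_mem L hmem)
  rintro _ ⟨u, ⟨hu, husum, hucard⟩, rfl⟩
  obtain ⟨m', hm', hrank, hKL⟩ := exists_rank_one_POVM hd v hv u hu husum hucard
  have hn1 := sum_mul_outProb_mul_log_nonneg hu husum h1 h0 hE1 hE0
  have hn2 := sum_mul_outProb_mul_log_nonneg hu husum h0 h1 hE0 hE1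
  refine ⟨?_, ?_, m', hm', hrank, ?_, ?_⟩
  · simpa [L, Fintype.linearCombination_apply] using mul_nonneg ht1 hn1
  · simpa [L, Fintype.linearCombination_apply] using mul_nonneg ht2 hn2
  · rw [hKL]
    simpa [L, Fintype.linearCombination_apply] using mul_le_of_le_one_left hn1 ht1'
  · rw [hKL]
    simpa [L, Fintype.linearCombination_apply] using mul_le_of_le_one_left hn2 ht2'

/-- Theorem 7 in the paper: for full-support states `ρ0, ρ1` on `ℂ^d`,
the closed convex hull of `C` equals the closed convex hull of `C⁽¹⁾`, the latter
using only rank-one POVMs with at most `d²` outcomes. -/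
theorem closed_convex_hull_C_eq_rank_one
    (d : ℕ) (hd : 0 < d) (ρ0 ρ1 : Mat (Fin d))
    (h0 : IsState ρ0) (h1 : IsState ρ1)
    (hfs0 : ρ0.PosDef) (hfs1 : ρ1.PosDef) :
    closure (convexHull ℝ (Cset ρ0 ρ1)) = closure (convexHull ℝ (C1set d ρ0 ρ1)) := by
  refine subset_antisymm (closure_mono (convexHull_min
    (Cset_subset_convexHull_C1set d hd ρ0 ρ1 h0.2 h1.2 hfs0 hfs1) (convex_convexHull ℝ _)))
    (closure_mono (convexHull_mono ?_))
  rintro R ⟨hR1, hR2, m, hm, -, hK1, hK2⟩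
  exact ⟨hR1, hR2, d * d, m, hm, hK1, hK2⟩

end SQHT
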